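/- Let Lin be the category whose objects are all linear orders and whose morphisms are order embeddings (strictly order-preserving injections), and let WO be the category whose objects are all well-ordered sets (linear orders in which every nonempty subset has a least element) and whose morphisms are order embeddings. Then there is no faithful functor F : Lin → WO. -/

import Mathlib

universe u

open CategoryTheory

/-- An object of the category `Lin`: a bundled linear order. -/
structure LinCat : Type (u + 1) where
  α : Type u
  str : LinearOrder α

attribute [instance] LinCat.str

/-- `Lin`: the category of all linear orders with order embeddings
(strictly order-preserving injections, i.e. `a ≤ b ↔ f a ≤ f b`) as morphisms. -/
instance : Category.{u} LinCat.{u} where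
  Hom M N := M.α ↪o N.α
  id M := RelEmbedding.refl _
  comp f g := f.trans g
  id_comp f := RelEmbedding.ext fun _ => rfl
  comp_id f := RelEmbedding.ext fun _ => rfl
  assoc f g h := RelEmbedding.ext fun _ => rfl

/-- An object of the category `WO`: a bundled well-ordered set, i.e. a linear order in
which every nonempty subset has a least element (equivalently, `<` is well-founded). -/
structure WOCat : Type (u + 1) where
  α : Type u
  str : LinearOrder α
  wo : ∀ s : Set α, s.Nonempty → ∃ a ∈ s, ∀ b ∈ s, a ≤ b

attribute [instance] WOCat.str

/-- `WO`: the category of all well-ordered sets with order embeddings as morphisms. -/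
instance : Category.{u} WOCat.{u} where
  Hom M N := M.α ↪o N.α
  id M := RelEmbedding.refl _
  comp f g := f.trans g
  id_comp f := RelEmbedding.ext fun _ => rfl
  comp_id f := RelEmbedding.ext fun _ => rfl
  assoc f g h := RelEmbedding.ext fun _ => rfl

instance WOCat.wellFoundedLT (W : WOCat.{u}) : WellFoundedLT W.α where
  wf := WellFounded.wellFounded_iff_has_min.2 fun s hs =>
    let ⟨a, ha, h⟩ := W.wo s hs
    ⟨a, ha, fun b hb => not_lt.2 (h b hb)⟩

/-- Well-ordered sets are rigid: their only automorphism is the identity. -/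
theorem WOCat.iso_hom_eq_id {W : WOCat.{u}} (e : W ≅ W) : e.hom = 𝟙 W := by
  let f : W.α ↪o W.α := e.hom
  let g : W.α ↪o W.α := e.inv
  have hgf (a : W.α) : g (f a) = a := congrArg (fun h : W.α ↪o W.α => h a) e.hom_inv_id
  refine RelEmbedding.ext fun a => ?_
  exact le_antisymm (g.strictMono.le_apply.trans_eq (hgf a)) f.strictMono.le_apply

/-- An order isomorphism, as an isomorphism in `Lin`. -/
def LinCat.isoOfOrderIso {M N : LinCat.{u}} (e : M.α ≃o N.α) : M ≅ N where
  hom := e.toOrderEmbedding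
  inv := e.symm.toOrderEmbedding
  hom_inv_id := RelEmbedding.ext e.symm_apply_apply
  inv_hom_id := RelEmbedding.ext e.apply_symm_apply

/-- The integers, as an object of `Lin`. -/
def LinCat.int : LinCat.{u} := ⟨ULift.{u} ℤ, inferInstance⟩

/-- The translation by one, as an automorphism of the linear order of the integers. -/
def LinCat.intShift : LinCat.int.{u} ≅ LinCat.int.{u} :=
  LinCat.isoOfOrderIso
    { toEquiv := (Equiv.ulift.trans (Equiv.addRight (1 : ℤ))).trans Equiv.ulift.symm
      map_rel_iff' := add_le_add_iff_right (1 : ℤ) }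

theorem LinCat.intShift_hom_ne_id : LinCat.intShift.{u}.hom ≠ 𝟙 _ := fun h => by
  have h0 : (0 + 1 : ℤ) = 0 :=
    congrArg (fun f : ULift.{u} ℤ ↪o ULift.{u} ℤ => (f (ULift.up 0)).down) h
  exact absurd h0 (by decide)

/-- **Statement 9.** There is no faithful functor from the category of linear orders and
order embeddings to the category of well-ordered sets and order embeddings. -/
theorem statement9 : ¬ ∃ F : LinCat.{u} ⥤ WOCat.{u}, F.Faithful := by
  rintro ⟨F, hF⟩
  refine LinCat.intShift_hom_ne_id (F.map_injective ?_)
  rw [F.map_id]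
  exact WOCat.iso_hom_eq_id (F.mapIso LinCat.intShift)
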